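/- Let n ≥ 1, let Ω ⊆ ℝⁿ⁺¹ be open, and let φ, ψ : Ω → ℝ be smooth functions satisfying the eikonal relations ⟨∇φ, ∇ψ⟩ = 0 and ‖∇φ‖ = ‖∇ψ‖ on Ω. Let W : Ω → ℝⁿ⁺¹ be C¹, let q : Ω → ℂ be any function, and let a : Ω → ℂ be C² and satisfy the transport equation ⟨∇ψ − i∇φ, −i∇a⟩ + ⟨∇ψ − i∇φ, W⟩·a + (1/(2i))·(Δψ − iΔφ)·a = 0 on Ω, where ⟨·,·⟩ is the complex-bilinear dot product. Then for every h > 0, h²·L_{W,q}(e^{(φ+iψ)/h}·a) = e^{(φ+iψ)/h}·h²·L_{W,q} a on Ω. -/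

import Mathlib

open MeasureTheory Complex Set

noncomputable section

/-- Euclidean space `ℝ^d`. -/
abbrev Euc (d : ℕ) := EuclideanSpace ℝ (Fin d)

/-- Partial derivative in the `j`-th coordinate direction. -/
def pd {d : ℕ} {F : Type*} [NormedAddCommGroup F] [NormedSpace ℝ F]
    (j : Fin d) (u : Euc d → F) : Euc d → F :=
  fun x => fderiv ℝ u x (EuclideanSpace.single j 1)

/-- The magnetic Schrödinger operator
`L_{W,q} u = -Δu - 2i⟨W,∇u⟩ - i (div W) u + (‖W‖² + q) u`. -/
def magSchrodinger {d : ℕ} (W : Euc d → Euc d) (q : Euc d → ℂ) (u : Euc d → ℂ) :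
    Euc d → ℂ :=
  fun x =>
    -(∑ j, pd j (pd j u) x)
    - 2 * Complex.I * ∑ j, ((W x j : ℝ) : ℂ) * pd j u x
    - Complex.I * (((∑ j, pd j (fun y => W y j) x) : ℝ) : ℂ) * u x
    + ((((‖W x‖ ^ 2 : ℝ)) : ℂ) + q x) * u x

/-- The logarithmic limiting Carleman weight `φ(x) = log ‖x‖`. -/
def carlWeight {d : ℕ} (x : Euc d) : ℝ := Real.log ‖x‖

/-- The conjugated operator `L_{φ,W,q} w = h² e^{φ/h} L_{W,q}(e^{-φ/h} w)`. -/
def conjOp {d : ℕ} (h : ℝ) (W : Euc d → Euc d) (q : Euc d → ℂ) (w : Euc d → ℂ) :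
    Euc d → ℂ :=
  fun x =>
    ((h : ℂ) ^ 2) * Complex.exp (((carlWeight x / h : ℝ) : ℂ)) *
      magSchrodinger W q
        (fun y => Complex.exp (((-(carlWeight y / h) : ℝ) : ℂ)) * w y) x

/-- The conjugated operator `L_{φ,W,q,ε} w = h² e^{φ/h + φ²/(2ε)} L_{W,q}(e^{-φ/h - φ²/(2ε)} w)`. -/
def conjOpEps {d : ℕ} (h ε : ℝ) (W : Euc d → Euc d) (q : Euc d → ℂ) (w : Euc d → ℂ) :
    Euc d → ℂ :=
  fun x =>
    ((h : ℂ) ^ 2) *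
      Complex.exp (((carlWeight x / h + (carlWeight x) ^ 2 / (2 * ε) : ℝ) : ℂ)) *
      magSchrodinger W q
        (fun y =>
          Complex.exp (((-(carlWeight y / h + (carlWeight y) ^ 2 / (2 * ε)) : ℝ) : ℂ)) * w y) x

/-- `w ∈ C_c^∞(U; ℂ)`. -/
def IsTest {d : ℕ} (U : Set (Euc d)) (w : Euc d → ℂ) : Prop :=
  ContDiff ℝ (⊤ : ℕ∞) w ∧ HasCompactSupport w ∧ tsupport w ⊆ U

/-- The `L²` norm on a set. -/
def L2normOn {d : ℕ} (U : Set (Euc d)) (w : Euc d → ℂ) : ℝ :=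
  Real.sqrt (∫ x in U, ‖w x‖ ^ 2)

/-- The semiclassical `H¹` norm on an open set. -/
def H1norm {d : ℕ} (h : ℝ) (U : Set (Euc d)) (ψ : Euc d → ℂ) : ℝ :=
  Real.sqrt ((∫ x in U, ‖ψ x‖ ^ 2) + h ^ 2 * ∫ x in U, ∑ j, ‖pd j ψ x‖ ^ 2)

/-- The semiclassical `H⁻¹` norm on an open set, defined by duality against
smooth compactly supported test functions. -/
def Hneg1norm {d : ℕ} (h : ℝ) (U : Set (Euc d)) (v : Euc d → ℂ) : ℝ :=
  sSup {r : ℝ | ∃ ψ : Euc d → ℂ, IsTest U ψ ∧ H1norm h U ψ ≤ 1 ∧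
    r = ‖∫ x in U, v x * (starRingEnd ℂ) (ψ x)‖}

section PartialDerivatives

variable {d : ℕ} {j : Fin d} {x : Euc d}

theorem pd_congr_of_eventuallyEq {F : Type*} [NormedAddCommGroup F] [NormedSpace ℝ F]
    {u v : Euc d → F} (huv : u =ᶠ[nhds x] v) : pd j u x = pd j v x := by
  simp only [pd, huv.fderiv_eq]

theorem pd_add {F : Type*} [NormedAddCommGroup F] [NormedSpace ℝ F] {u v : Euc d → F}
    (hu : DifferentiableAt ℝ u x) (hv : DifferentiableAt ℝ v x) :
    pd j (fun y => u y + v y) x = pd j u x + pd j v x := by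
  simp [pd, fderiv_fun_add hu hv]

theorem pd_mul {u v : Euc d → ℂ} (hu : DifferentiableAt ℝ u x)
    (hv : DifferentiableAt ℝ v x) :
    pd j (fun y => u y * v y) x = u x * pd j v x + pd j u x * v x := by
  simp [pd, fderiv_fun_mul hu hv, mul_comm]

theorem pd_cexp {g : Euc d → ℂ} (hg : DifferentiableAt ℝ g x) :
    pd j (fun y => Complex.exp (g y)) x = Complex.exp (g x) * pd j g x := by
  simp [pd, hg.hasFDerivAt.cexp.fderiv]

theorem pd_cexp_mul {g a : Euc d → ℂ} (hg : DifferentiableAt ℝ g x)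
    (ha : DifferentiableAt ℝ a x) :
    pd j (fun y => Complex.exp (g y) * a y) x =
      Complex.exp (g x) * (pd j g x * a x + pd j a x) := by
  rw [pd_mul hg.cexp ha, pd_cexp hg]
  ring

theorem ContDiffAt.differentiableAt_pd {F : Type*} [NormedAddCommGroup F] [NormedSpace ℝ F]
    {u : Euc d → F} (hu : ContDiffAt ℝ 2 u x) : DifferentiableAt ℝ (pd j u) x := by
  have hu' : ContDiffAt ℝ 1 (fderiv ℝ u) x := hu.fderiv_right (by norm_num)
  exact (hu'.differentiableAt (by norm_num)).clm_apply (differentiableAt_const _)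

theorem ContDiffAt.eventually_differentiableAt {F : Type*} [NormedAddCommGroup F]
    [NormedSpace ℝ F] {u : Euc d → F} (hu : ContDiffAt ℝ 2 u x) :
    ∀ᶠ y in nhds x, DifferentiableAt ℝ u y :=
  (hu.eventually (by simp)).mono fun _ hy => hy.differentiableAt (by norm_num)

theorem pd_pd_cexp_mul {g a : Euc d → ℂ} (hg : ContDiffAt ℝ 2 g x)
    (ha : ContDiffAt ℝ 2 a x) :
    pd j (pd j fun y => Complex.exp (g y) * a y) x =
      Complex.exp (g x) * (pd j (pd j a) x + 2 * (pd j g x * pd j a x) +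
        pd j g x ^ 2 * a x + pd j (pd j g) x * a x) := by
  have hev : pd j (fun y => Complex.exp (g y) * a y) =ᶠ[nhds x]
      fun y => Complex.exp (g y) * (pd j g y * a y + pd j a y) := by
    filter_upwards [hg.eventually_differentiableAt, ha.eventually_differentiableAt]
      with y hgy hay using pd_cexp_mul hgy hay
  have hg1 : DifferentiableAt ℝ g x := hg.differentiableAt (by norm_num)
  have ha1 : DifferentiableAt ℝ a x := ha.differentiableAt (by norm_num)
  have hga : DifferentiableAt ℝ (fun y => pd j g y * a y) x :=
    hg.differentiableAt_pd.mul ha1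
  rw [pd_congr_of_eventuallyEq hev, pd_cexp_mul hg1 (hga.fun_add ha.differentiableAt_pd),
    pd_add hga ha.differentiableAt_pd, pd_mul hg.differentiableAt_pd ha1]
  ring

/-- Conjugating the magnetic Schrödinger operator by `exp g`. -/
theorem magSchrodinger_cexp_mul (W : Euc d → Euc d) (q : Euc d → ℂ) {g a : Euc d → ℂ}
    (hg : ContDiffAt ℝ 2 g x) (ha : ContDiffAt ℝ 2 a x) :
    magSchrodinger W q (fun y => Complex.exp (g y) * a y) x =
      Complex.exp (g x) * (magSchrodinger W q a x - 2 * ∑ j, pd j g x * pd j a x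
        - (∑ j, pd j g x ^ 2) * a x - (∑ j, pd j (pd j g) x) * a x
        - 2 * Complex.I * (∑ j, ((W x j : ℝ) : ℂ) * pd j g x) * a x) := by
  have hfirst : ∑ j, ((W x j : ℝ) : ℂ) * pd j (fun y => Complex.exp (g y) * a y) x =
      Complex.exp (g x) * ((∑ j, ((W x j : ℝ) : ℂ) * pd j g x) * a x +
        ∑ j, ((W x j : ℝ) : ℂ) * pd j a x) := by
    rw [Finset.sum_mul, ← Finset.sum_add_distrib, Finset.mul_sum]
    refine Finset.sum_congr rfl fun j _ => ?_
    rw [pd_cexp_mul (hg.differentiableAt (by norm_num)) (ha.differentiableAt (by norm_num))]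
    ring
  have hsecond : ∑ j, pd j (pd j fun y => Complex.exp (g y) * a y) x =
      Complex.exp (g x) * (∑ j, pd j (pd j a) x + 2 * ∑ j, pd j g x * pd j a x +
        (∑ j, pd j g x ^ 2) * a x + (∑ j, pd j (pd j g) x) * a x) := by
    rw [Finset.mul_sum, Finset.sum_mul, Finset.sum_mul]
    simp only [← Finset.sum_add_distrib]
    rw [Finset.mul_sum]
    exact Finset.sum_congr rfl fun j _ => pd_pd_cexp_mul hg ha
  simp only [magSchrodinger]
  rw [hfirst, hsecond]
  ring

theorem pd_ofReal_add_I_mul_ofReal_div {φ ψ : Euc d → ℝ} (hφ : DifferentiableAt ℝ φ x)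
    (hψ : DifferentiableAt ℝ ψ x) (c : ℂ) :
    pd j (fun y => ((φ y : ℂ) + Complex.I * (ψ y : ℂ)) / c) x =
      (((pd j φ x : ℝ) : ℂ) + Complex.I * ((pd j ψ x : ℝ) : ℂ)) / c := by
  have hφ' := Complex.ofRealCLM.hasFDerivAt.comp x hφ.hasFDerivAt
  have hψ' := Complex.ofRealCLM.hasFDerivAt.comp x hψ.hasFDerivAt
  have h := (hφ'.add (hψ'.const_mul Complex.I)).mul_const c⁻¹
  have h' : HasFDerivAt (fun y => ((φ y : ℂ) + Complex.I * (ψ y : ℂ)) / c) _ x := h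
  rw [pd, h'.fderiv]
  simp [pd, div_eq_mul_inv, mul_comm, mul_add]

theorem pd_pd_ofReal_add_I_mul_ofReal_div {φ ψ : Euc d → ℝ} (hφ : ContDiffAt ℝ 2 φ x)
    (hψ : ContDiffAt ℝ 2 ψ x) (c : ℂ) :
    pd j (pd j fun y => ((φ y : ℂ) + Complex.I * (ψ y : ℂ)) / c) x =
      (((pd j (pd j φ) x : ℝ) : ℂ) + Complex.I * ((pd j (pd j ψ) x : ℝ) : ℂ)) / c := by
  rw [← pd_ofReal_add_I_mul_ofReal_div hφ.differentiableAt_pd hψ.differentiableAt_pd]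
  refine pd_congr_of_eventuallyEq ?_
  filter_upwards [hφ.eventually_differentiableAt, hψ.eventually_differentiableAt]
    with y hφy hψy using pd_ofReal_add_I_mul_ofReal_div hφy hψy c

end PartialDerivatives

/-- WKB conjugation identity: if `a` solves the transport equation associated with a
pair `(φ, ψ)` satisfying the eikonal equation, then
`h² L_{W,q}(e^{(φ+iψ)/h} a) = e^{(φ+iψ)/h} h² L_{W,q} a`. -/
theorem stmt14 (n : ℕ) (hn : 1 ≤ n)
    (Ω : Set (Euc (n + 1))) (hΩ : IsOpen Ω)
    (φ ψ : Euc (n + 1) → ℝ)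
    (hφ : ContDiffOn ℝ (⊤ : ℕ∞) φ Ω) (hψ : ContDiffOn ℝ (⊤ : ℕ∞) ψ Ω)
    (heik1 : ∀ x ∈ Ω, (∑ j, pd j φ x * pd j ψ x) = 0)
    (heik2 : ∀ x ∈ Ω,
      Real.sqrt (∑ j, (pd j φ x) ^ 2) = Real.sqrt (∑ j, (pd j ψ x) ^ 2))
    (W : Euc (n + 1) → Euc (n + 1)) (hW : ContDiffOn ℝ 1 W Ω)
    (q : Euc (n + 1) → ℂ)
    (a : Euc (n + 1) → ℂ) (ha : ContDiffOn ℝ 2 a Ω)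
    (htransport : ∀ x ∈ Ω,
      (∑ j, (((pd j ψ x : ℝ) : ℂ) - Complex.I * ((pd j φ x : ℝ) : ℂ)) *
          (-Complex.I * pd j a x)) +
        (∑ j, (((pd j ψ x : ℝ) : ℂ) - Complex.I * ((pd j φ x : ℝ) : ℂ)) *
          ((W x j : ℝ) : ℂ)) * a x +
        (1 / (2 * Complex.I)) *
          ((((∑ j, pd j (pd j ψ) x) : ℝ) : ℂ) -
            Complex.I * (((∑ j, pd j (pd j φ) x) : ℝ) : ℂ)) * a x = 0) :
    ∀ h : ℝ, 0 < h → ∀ x ∈ Ω,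
      ((h : ℂ)) ^ 2 *
          magSchrodinger W q
            (fun y =>
              Complex.exp ((((φ y : ℝ) : ℂ) + Complex.I * ((ψ y : ℝ) : ℂ)) / (h : ℂ)) * a y)
            x =
        Complex.exp ((((φ x : ℝ) : ℂ) + Complex.I * ((ψ x : ℝ) : ℂ)) / (h : ℂ)) *
          (((h : ℂ)) ^ 2 * magSchrodinger W q a x) := by
  intro h hh x hx
  have hΩx := hΩ.mem_nhds hx
  have hφx : ContDiffAt ℝ 2 φ x := (hφ.contDiffAt hΩx).of_le (by norm_cast)
  have hψx : ContDiffAt ℝ 2 ψ x := (hψ.contDiffAt hΩx).of_le (by norm_cast)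
  have hax : ContDiffAt ℝ 2 a x := ha.contDiffAt hΩx
  have hh0 : (h : ℂ) ≠ 0 := by exact_mod_cast hh.ne'
  have hgx : ContDiffAt ℝ 2
      (fun y => (((φ y : ℝ) : ℂ) + Complex.I * ((ψ y : ℝ) : ℂ)) / (h : ℂ)) x :=
    ((Complex.ofRealCLM.contDiff.contDiffAt.comp x hφx).add
      (contDiffAt_const.mul (Complex.ofRealCLM.contDiff.contDiffAt.comp x hψx))).div_const _
  have hsq : ∑ j, pd j φ x ^ 2 = ∑ j, pd j ψ x ^ 2 :=
    (Real.sqrt_inj (Finset.sum_nonneg fun _ _ => sq_nonneg _)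
      (Finset.sum_nonneg fun _ _ => sq_nonneg _)).1 (heik2 x hx)
  have heikonal : ∑ j, ((((pd j φ x : ℝ) : ℂ) + Complex.I * ((pd j ψ x : ℝ) : ℂ)) / (h : ℂ)) ^ 2 = 0 := by
    have hsq' : ∑ j, ((pd j φ x : ℝ) : ℂ) ^ 2 = ∑ j, ((pd j ψ x : ℝ) : ℂ) ^ 2 := by exact_mod_cast hsq
    have horth : ∑ j, ((pd j φ x : ℝ) : ℂ) * ((pd j ψ x : ℝ) : ℂ) = 0 := by exact_mod_cast heik1 x hx
    have hexpand : ∀ j, ((((pd j φ x : ℝ) : ℂ) + Complex.I * ((pd j ψ x : ℝ) : ℂ)) / (h : ℂ)) ^ 2 =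
        (((pd j φ x : ℝ) : ℂ) ^ 2 - ((pd j ψ x : ℝ) : ℂ) ^ 2 +
          2 * Complex.I * (((pd j φ x : ℝ) : ℂ) * ((pd j ψ x : ℝ) : ℂ))) / (h : ℂ) ^ 2 := fun j => by
      rw [div_pow]
      congr 1
      linear_combination ((pd j ψ x : ℝ) : ℂ) ^ 2 * Complex.I_sq
    simp only [hexpand]
    rw [← Finset.sum_div, Finset.sum_add_distrib, Finset.sum_sub_distrib, ← Finset.mul_sum,
      hsq', horth]
    simp
  have htr := htransport x hx
  have hgrad : ∑ j, (((pd j ψ x : ℝ) : ℂ) - Complex.I * ((pd j φ x : ℝ) : ℂ)) *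
      (-Complex.I * pd j a x) =
      -(h : ℂ) * ∑ j, (((pd j φ x : ℝ) : ℂ) + Complex.I * ((pd j ψ x : ℝ) : ℂ)) / (h : ℂ) * pd j a x := by
    rw [Finset.mul_sum]
    refine Finset.sum_congr rfl fun j _ => ?_
    field_simp
    linear_combination ((pd j φ x : ℝ) : ℂ) * pd j a x * Complex.I_sq
  have hmag : ∑ j, (((pd j ψ x : ℝ) : ℂ) - Complex.I * ((pd j φ x : ℝ) : ℂ)) *
      ((W x j : ℝ) : ℂ) =
      -Complex.I * (h : ℂ) *
        ∑ j, ((W x j : ℝ) : ℂ) * ((((pd j φ x : ℝ) : ℂ) + Complex.I * ((pd j ψ x : ℝ) : ℂ)) / (h : ℂ)) := by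
    rw [Finset.mul_sum]
    refine Finset.sum_congr rfl fun j _ => ?_
    field_simp
    linear_combination ((pd j ψ x : ℝ) : ℂ) * ((W x j : ℝ) : ℂ) * Complex.I_sq
  have hlap : (1 / (2 * Complex.I)) * ((((∑ j, pd j (pd j ψ) x) : ℝ) : ℂ) -
      Complex.I * (((∑ j, pd j (pd j φ) x) : ℝ) : ℂ)) =
      -((h : ℂ) / 2) *
        ∑ j, (((pd j (pd j φ) x : ℝ) : ℂ) + Complex.I * ((pd j (pd j ψ) x : ℝ) : ℂ)) / (h : ℂ) := by
    rw [← Finset.sum_div, Finset.sum_add_distrib, ← Finset.mul_sum]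
    push_cast
    field_simp [Complex.I_ne_zero]
    linear_combination (∑ j, ((pd j (pd j ψ) x : ℝ) : ℂ)) * Complex.I_sq
  rw [hgrad, hmag, hlap] at htr
  rw [magSchrodinger_cexp_mul W q hgx hax]
  simp only [pd_pd_ofReal_add_I_mul_ofReal_div hφx hψx,
    pd_ofReal_add_I_mul_ofReal_div (hφx.differentiableAt (by norm_num))
      (hψx.differentiableAt (by norm_num))]
  rw [heikonal]
  linear_combination
    2 * (h : ℂ) * Complex.exp ((((φ x : ℝ) : ℂ) + Complex.I * ((ψ x : ℝ) : ℂ)) / (h : ℂ)) * htr
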